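/- arXiv:math/0402158 — 2 statements merged into one kernel-verified Lean document; each statement's English description precedes it below -/
import Mathlib

section
/- Let n ≥ 2, k ≥ 1 and 1 ≤ d ≤ k. Let h be a harmonic homogeneous polynomial of degree 2d in n variables and set f = r^{2k−2d}·h, where r² = x₁²+⋯+x_n². Then ⟨f,f⟩_G = ((2k²+d(n−2)+2d²)/(2k²))·⟨f,f⟩; equivalently, ∫_{S^{n-1}} ⟨∇f,∇f⟩ dσ = 2·(2k²+d(n−2)+2d²) · ∫_{S^{n-1}} h² dσ. -/
open MeasureTheory MvPolynomial

noncomputable section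

/-- The rotation-invariant probability measure `σ` on the unit sphere `S^{m-1} ⊆ ℝ^m`
(the normalization of the surface measure). -/
def sphereMeasure (m : ℕ) : Measure (Metric.sphere (0 : EuclideanSpace ℝ (Fin m)) 1) :=
  ((volume : Measure (EuclideanSpace ℝ (Fin m))).toSphere Set.univ)⁻¹ •
    (volume : Measure (EuclideanSpace ℝ (Fin m))).toSphere

/-- Evaluation of a polynomial at a point of the unit sphere. -/
def evalS {m : ℕ} (f : MvPolynomial (Fin m) ℝ)
    (v : Metric.sphere (0 : EuclideanSpace ℝ (Fin m)) 1) : ℝ :=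
  eval (fun i => (v : EuclideanSpace ℝ (Fin m)) i) f

/-- The L² inner product `⟨f,g⟩ = ∫_{S^{n-1}} f·g dσ`. -/
def L2inner (n : ℕ) (f g : MvPolynomial (Fin n) ℝ) : ℝ :=
  ∫ v, evalS f v * evalS g v ∂(sphereMeasure n)

/-- `r^{2k} = (x₁² + ⋯ + x_n²)^k`. -/
def rPow (n k : ℕ) : MvPolynomial (Fin n) ℝ := (∑ i : Fin n, X i ^ 2) ^ k

/-- Membership in the hyperplane `M` of forms of degree `2k` with integral 0 on the sphere. -/
def memM (n k : ℕ) (f : MvPolynomial (Fin n) ℝ) : Prop :=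
  f.IsHomogeneous (2 * k) ∧ (∫ v, evalS f v ∂(sphereMeasure n)) = 0

/-- `D_M = C(n+2k-1, 2k) - 1`, the dimension of `M`. -/
def DM (n k : ℕ) : ℕ := Nat.choose (n + 2 * k - 1) (2 * k) - 1

/-- The unit ball of the L² metric in `M`. -/
def BM (n k : ℕ) : Set (MvPolynomial (Fin n) ℝ) :=
  {f | memM n k f ∧ L2inner n f f ≤ 1}

/-- The section `C̃` of the cone of nonnegative forms: `f ∈ M` with `f + r^{2k}` nonnegative. -/
def Ctilde (n k : ℕ) : Set (MvPolynomial (Fin n) ℝ) :=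
  {f | memM n k f ∧ ∀ x : Fin n → ℝ, 0 ≤ eval x (f + rPow n k)}

/-- `f` is a sum of squares of forms of degree `k`. -/
def IsSOS (n k : ℕ) (f : MvPolynomial (Fin n) ℝ) : Prop :=
  ∃ (m : ℕ) (g : Fin m → MvPolynomial (Fin n) ℝ),
    (∀ i, (g i).IsHomogeneous k) ∧ f = ∑ i, g i ^ 2

/-- The section `S̃q` of the cone of sums of squares. -/
def SqTilde (n k : ℕ) : Set (MvPolynomial (Fin n) ℝ) :=
  {f | memM n k f ∧ IsSOS n k (f + rPow n k)}

/-- `f` is a sum of `2k`-th powers of linear forms. -/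
def IsSOP (n k : ℕ) (f : MvPolynomial (Fin n) ℝ) : Prop :=
  ∃ (m : ℕ) (l : Fin m → MvPolynomial (Fin n) ℝ),
    (∀ i, (l i).IsHomogeneous 1) ∧ f = ∑ i, l i ^ (2 * k)

/-- The section `L̃f` of the cone of sums of `2k`-th powers of linear forms. -/
def LfTilde (n k : ℕ) : Set (MvPolynomial (Fin n) ℝ) :=
  {f | memM n k f ∧ IsSOP n k (f + rPow n k)}

/-- `‖f‖_∞ = max_{x ∈ S^{n-1}} |f(x)|`. -/
def supNorm (n : ℕ) (f : MvPolynomial (Fin n) ℝ) : ℝ :=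
  ⨆ v : Metric.sphere (0 : EuclideanSpace ℝ (Fin n)) 1, |evalS f v|

/-- The gradient inner product `⟨f,g⟩_G = (1/(4k²)) ∫_{S^{n-1}} ⟨∇f,∇g⟩ dσ`. -/
def gradInner (n k : ℕ) (f g : MvPolynomial (Fin n) ℝ) : ℝ :=
  (1 / (4 * (k : ℝ) ^ 2)) *
    ∫ v, (∑ i : Fin n, evalS (pderiv i f) v * evalS (pderiv i g) v) ∂(sphereMeasure n)

/-- The unit ball of the gradient metric in `M`. -/
def BG (n k : ℕ) : Set (MvPolynomial (Fin n) ℝ) :=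
  {f | memM n k f ∧ gradInner n k f f ≤ 1}

/-- The differential (apolar) inner product `⟨f,g⟩_d = D_f(g) = ∑_α α! c_α(f) c_α(g)`. -/
def diffInner (n : ℕ) (f g : MvPolynomial (Fin n) ℝ) : ℝ :=
  ∑ α ∈ f.support, (∏ i, (Nat.factorial (α i) : ℝ)) * f.coeff α * g.coeff α

/-- The linear form `v₁x₁ + ⋯ + v_nx_n`. -/
def linForm (n : ℕ) (v : Fin n → ℝ) : MvPolynomial (Fin n) ℝ :=
  ∑ i, C (v i) * X i

/-- The norm `‖f‖_sq = max { |⟨f, g²⟩| : g ∈ P_{n,k}, ∫ g² dσ = 1 }`. -/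
def sqNorm (n k : ℕ) (f : MvPolynomial (Fin n) ℝ) : ℝ :=
  ⨆ g : {g : MvPolynomial (Fin n) ℝ // g.IsHomogeneous k ∧ L2inner n g g = 1},
    |L2inner n f ((g : MvPolynomial (Fin n) ℝ) ^ 2)|

/-- The dual cone of `L` in the L² (integral) metric, inside `P_{n,2k}`. -/
def dualI (n k : ℕ) (L : Set (MvPolynomial (Fin n) ℝ)) : Set (MvPolynomial (Fin n) ℝ) :=
  {f | f.IsHomogeneous (2 * k) ∧ ∀ g ∈ L, 0 ≤ L2inner n f g}

/-- The dual cone of `L` in the differential metric, inside `P_{n,2k}`. -/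
def dualD (n k : ℕ) (L : Set (MvPolynomial (Fin n) ℝ)) : Set (MvPolynomial (Fin n) ℝ) :=
  {f | f.IsHomogeneous (2 * k) ∧ ∀ g ∈ L, 0 ≤ diffInner n f g}


abbrev EE (n : ℕ) := EuclideanSpace ℝ (Fin n)

def evE {n : ℕ} (f : MvPolynomial (Fin n) ℝ) (x : EE n) : ℝ := eval (fun i => x i) f

lemma evE_smul {n D : ℕ} {f : MvPolynomial (Fin n) ℝ} (hf : f.IsHomogeneous D) (r : ℝ)
    (x : EE n) : evE f (r • x) = r ^ D * evE f x := by
  unfold evE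
  rw [eval_eq', eval_eq', Finset.mul_sum]
  refine Finset.sum_congr rfl fun a ha => ?_
  have hD : ∑ i, a i = D := by
    have := hf (mem_support_iff.1 ha)
    rw [← this, Finsupp.weight_apply, Finsupp.sum_fintype] <;> simp
  simp only [PiLp.smul_apply, smul_eq_mul, mul_pow, Finset.prod_mul_distrib]
  rw [Finset.prod_pow_eq_pow_sum, hD]
  ring

lemma continuous_evE {n : ℕ} (f : MvPolynomial (Fin n) ℝ) : Continuous (evE f) := by
  unfold evE
  exact (MvPolynomial.continuous_eval f).comp (by fun_prop)

lemma continuous_evalS {n : ℕ} (f : MvPolynomial (Fin n) ℝ) : Continuous (evalS f) :=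
  (continuous_evE f).comp continuous_subtype_val

lemma hasLineDerivAt_evE {n : ℕ} (f : MvPolynomial (Fin n) ℝ) (i : Fin n) (x : EE n) :
    HasLineDerivAt ℝ (evE f) (evE (pderiv i f) x) x (EuclideanSpace.single i 1) := by
  induction f using MvPolynomial.induction_on with
  | C a =>
    simp only [HasLineDerivAt, evE, eval_C, pderiv_C, map_zero]
    exact hasDerivAt_const _ _
  | add p q hp hq =>
    simp only [HasLineDerivAt, evE, map_add] at *
    exact hp.add hq
  | mul_X p j hp =>
    have hX : HasDerivAt (fun t : ℝ => (x + t • EuclideanSpace.single i (1:ℝ)) j)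
        (if i = j then 1 else 0) 0 := by
      have : (fun t : ℝ => (x + t • EuclideanSpace.single i (1:ℝ)) j) =
          fun t => x j + t * (if i = j then 1 else 0) := by
        funext t; simp [eq_comm]
      rw [this]
      simpa using ((hasDerivAt_id (0:ℝ)).mul_const (if i = j then (1:ℝ) else 0)).const_add (x j)
    have hp' : HasDerivAt (fun t : ℝ => evE p (x + t • EuclideanSpace.single i (1:ℝ)))
        (evE (pderiv i p) x) 0 := hp
    have hfun : (fun t : ℝ => evE (p * X j) (x + t • EuclideanSpace.single i (1:ℝ))) =
        fun t => evE p (x + t • EuclideanSpace.single i (1:ℝ)) *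
          (x + t • EuclideanSpace.single i (1:ℝ)) j := by
      funext t; simp only [evE, map_mul, eval_X]
    unfold HasLineDerivAt
    rw [hfun]
    refine (hp'.mul hX).congr_deriv ?_
    unfold evE
    simp [Derivation.leibniz, pderiv_X, Pi.single_apply]
    by_cases hij : i = j
    · subst hij; simp; ring
    · simp [hij, Ne.symm hij]; ring

def gw {n : ℕ} (x : EE n) : ℝ := Real.exp (-‖x‖ ^ 2)

lemma hasLineDerivAt_gw {n : ℕ} (i : Fin n) (x : EE n) :
    HasLineDerivAt ℝ gw (-(2 * x i * gw x)) x (EuclideanSpace.single i 1) := by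
  have h := ((hasStrictFDerivAt_norm_sq x).hasFDerivAt.neg).exp
  have h2 := h.hasLineDerivAt (EuclideanSpace.single i (1:ℝ))
  have h3 : HasDerivAt (fun t : ℝ => gw (x + t • EuclideanSpace.single i (1:ℝ))) _ 0 := h2
  refine h3.congr_deriv ?_
  simp [gw, EuclideanSpace.inner_single_right]
  ring

/-- the radial moments -/
def JJ (m : ℕ) : ℝ := ∫ r in Set.Ioi (0:ℝ), r ^ m * Real.exp (-r ^ 2)

lemma JJ_eq (m : ℕ) : JJ m = 1 / 2 * Real.Gamma (((m : ℝ) + 1) / 2) := by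
  have := integral_rpow_mul_exp_neg_mul_rpow (p := 2) (q := m) (b := 1) (by norm_num)
    (by have : (0:ℝ) ≤ m := by positivity
        linarith) one_pos
  simpa [JJ] using this

lemma JJ_pos (m : ℕ) : 0 < JJ m := by
  rw [JJ_eq]
  have := Real.Gamma_pos_of_pos (s := ((m:ℝ) + 1) / 2) (by positivity)
  positivity

lemma JJ_add_two (m : ℕ) : JJ (m + 2) = ((m : ℝ) + 1) / 2 * JJ m := by
  rw [JJ_eq, JJ_eq]
  have : (((m + 2 : ℕ) : ℝ) + 1) / 2 = ((m : ℝ) + 1) / 2 + 1 := by push_cast; ring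
  rw [this, Real.Gamma_add_one (by positivity)]
  ring

lemma JJ_int (m : ℕ) : IntegrableOn (fun r : ℝ => r ^ m * Real.exp (-r ^ 2)) (Set.Ioi 0) := by
  have := integrableOn_rpow_mul_exp_neg_mul_sq (b := 1) one_pos (s := m)
    (by have : (0:ℝ) ≤ m := by positivity
        linarith)
  simpa using this

lemma radial {m D : ℕ} :
    Integrable (fun r : Set.Ioi (0:ℝ) => r.1 ^ D * Real.exp (-r.1 ^ 2))
      (Measure.volumeIoiPow m) ∧
    ∫ r : Set.Ioi (0:ℝ), r.1 ^ D * Real.exp (-r.1 ^ 2) ∂(Measure.volumeIoiPow m)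
      = JJ (m + D) := by
  constructor
  · rw [Measure.volumeIoiPow, integrable_withDensity_iff_integrable_smul']
    · have h := (integrableOn_iff_comap_subtypeVal measurableSet_Ioi).1 (JJ_int (m + D))
      refine h.congr (.of_forall ?_)
      rintro ⟨x, hx : 0 < x⟩
      simp (disch := positivity) [ENNReal.toReal_ofReal]
      ring
    · fun_prop
    · simp
  · simp only [Measure.volumeIoiPow, ENNReal.ofReal]
    rw [integral_withDensity_eq_integral_smul,
        integral_subtype_comap measurableSet_Ioi
          fun a : ℝ ↦ Real.toNNReal (a ^ m) • (a ^ D * Real.exp (-a ^ 2)), JJ,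
        setIntegral_congr_fun measurableSet_Ioi fun x hx ↦ ?_]
    · rw [NNReal.smul_def, Real.coe_toNNReal _ (pow_nonneg hx.out.le _)]
      simp; ring
    · exact (measurable_subtype_coe.pow_const _).real_toNNReal

lemma polar {n D : ℕ} (hn : 2 ≤ n) {f : MvPolynomial (Fin n) ℝ} (hf : f.IsHomogeneous D) :
    Integrable (fun x : EE n => evE f x * gw x) ∧
    ∫ x : EE n, evE f x * gw x =
      (∫ v, evalS f v ∂(volume : Measure (EE n)).toSphere) * JJ (n - 1 + D) := by
  have hdim : Module.finrank ℝ (EE n) = n := by simp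
  have key : ∀ x : ({0}ᶜ : Set (EE n)), evE f x.1 * gw x.1 =
      (fun z : Metric.sphere (0 : EE n) 1 × Set.Ioi (0:ℝ) =>
        evalS f z.1 * (z.2.1 ^ D * Real.exp (-z.2.1 ^ 2))) (homeomorphUnitSphereProd (EE n) x) := by
    intro x
    have hx : ‖x.1‖ ≠ 0 := norm_ne_zero_iff.2 x.2
    have h1 : evE f x.1 = ‖x.1‖ ^ D * evE f (‖x.1‖⁻¹ • x.1) := by
      rw [← evE_smul hf, smul_smul, mul_inv_cancel₀ hx, one_smul]
    have h2 : evalS f (homeomorphUnitSphereProd (EE n) x).1 = evE f (‖x.1‖⁻¹ • x.1) := by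
      rw [← homeomorphUnitSphereProd_apply_fst_coe]; rfl
    simp only [h2, homeomorphUnitSphereProd_apply_snd_coe, gw]
    rw [h1]; ring
  have mp := (volume : Measure (EE n)).measurePreserving_homeomorphUnitSphereProd
  rw [hdim] at mp
  have hS : Integrable (evalS f) (volume : Measure (EE n)).toSphere :=
    (continuous_evalS f).integrable_of_hasCompactSupport (HasCompactSupport.of_compactSpace _)
  have : Nonempty (Fin n) := ⟨⟨0, by omega⟩⟩
  have : Nontrivial (EE n) := inferInstance
  constructor
  · rw [← restrict_compl_singleton (μ := (volume : Measure (EE n))) 0, ← IntegrableOn,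
      integrableOn_iff_comap_subtypeVal (by measurability)]
    have := (mp.integrable_comp_emb (Homeomorph.measurableEmbedding _)).2
      (hS.mul_prod (radial (m := n - 1) (D := D)).1)
    refine this.congr (.of_forall fun x => ?_)
    exact (key x).symm
  · calc
      _ = ∫ x : ({(0)}ᶜ : Set (EE n)), evE f x.1 * gw x.1 ∂((volume : Measure (EE n)).comap (↑)) := by
        rw [integral_subtype_comap (measurableSet_singleton _).compl
          fun x : EE n ↦ evE f x * gw x, restrict_compl_singleton]
      _ = _ := by
        rw [integral_congr_ae (.of_forall key),
          mp.integral_comp (Homeomorph.measurableEmbedding _)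
            (fun z : Metric.sphere (0 : EE n) 1 × Set.Ioi (0:ℝ) =>
              evalS f z.1 * (z.2.1 ^ D * Real.exp (-z.2.1 ^ 2))),
          integral_prod_mul (evalS f) (fun r : Set.Ioi (0:ℝ) => r.1 ^ D * Real.exp (-r.1 ^ 2)),
          (radial (m := n - 1) (D := D)).2]

lemma pderiv_ibp {n D : ℕ} (hn : 2 ≤ n) {f : MvPolynomial (Fin n) ℝ}
    (hf : f.IsHomogeneous (D + 1)) (i : Fin n) :
    ∫ x : EE n, evE (pderiv i f) x * gw x = 2 * ∫ x : EE n, evE (X i * f) x * gw x := by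
  have h1 := (polar hn (hf.pderiv (i := i))).1
  have h2 := (polar hn hf).1
  have h3 := (polar hn ((isHomogeneous_X ℝ i).mul hf)).1
  have := integral_bilinear_hasLineDerivAt_right_eq_neg_left_of_integrable
    (μ := (volume : Measure (EE n))) (B := ContinuousLinearMap.mul ℝ ℝ)
    (f := evE f) (f' := evE (pderiv i f)) (g := gw) (g' := fun x => -(2 * x i * gw x))
    (v := EuclideanSpace.single i 1) (by simpa using h1) ?_ (by simpa using h2)
    (fun x _ => hasLineDerivAt_evE f i x) (fun x _ => hasLineDerivAt_gw i x)
  · simp only [ContinuousLinearMap.mul_apply'] at this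
    rw [← neg_eq_iff_eq_neg] at this
    rw [← this, ← integral_const_mul, ← integral_neg]
    refine integral_congr_ae (.of_forall fun x => ?_)
    simp [evE]; ring
  · refine (h3.const_mul (-2)).congr (.of_forall fun x => ?_)
    simp [evE]; ring

lemma sphere_laplacian {n D : ℕ} (hn : 2 ≤ n) {p : MvPolynomial (Fin n) ℝ}
    (hp : p.IsHomogeneous (D + 2)) :
    ∫ v, evalS (∑ i, pderiv i (pderiv i p)) v ∂(sphereMeasure n) =
      ((D : ℝ) + 2) * (D + n) * ∫ v, evalS p v ∂(sphereMeasure n) := by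
  have hL : (∑ i, pderiv i (pderiv i p)).IsHomogeneous D :=
    IsHomogeneous.sum _ _ _ fun i _ => (hp.pderiv (i := i)).pderiv (i := i)
  have hd : ∀ i, (pderiv i p).IsHomogeneous (D + 1) := fun i => hp.pderiv (i := i)
  have e1 : ∫ x : EE n, evE (∑ i, pderiv i (pderiv i p)) x * gw x =
      2 * ((D : ℝ) + 2) * ∫ x : EE n, evE p x * gw x := by
    calc _ = ∑ i, ∫ x : EE n, evE (pderiv i (pderiv i p)) x * gw x := by
          rw [← integral_finsetSum]
          · simp [evE, Finset.sum_mul]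
          · intro i _
            exact (polar hn ((hd i).pderiv (i := i))).1
      _ = ∑ i, 2 * ∫ x : EE n, evE (X i * pderiv i p) x * gw x :=
          Finset.sum_congr rfl fun i _ => pderiv_ibp hn (hd i) i
      _ = 2 * ∫ x : EE n, evE (∑ i, X i * pderiv i p) x * gw x := by
          rw [← Finset.mul_sum, ← integral_finsetSum]
          · simp [evE, Finset.sum_mul]
          · intro i _
            exact (polar hn ((isHomogeneous_X ℝ i).mul (hd i))).1
      _ = _ := by
          rw [hp.sum_X_mul_pderiv, mul_assoc, ← integral_const_mul ((D : ℝ) + 2)]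
          congr 1
          congr 1
          funext x
          simp [evE]; ring
  rw [(polar hn hL).2, (polar hn hp).2, ← add_assoc, JJ_add_two] at e1
  have hn1 : ((n - 1 + D : ℕ) : ℝ) + 1 = D + n := by
    have : n - 1 + D + 1 = D + n := by omega
    exact_mod_cast this
  rw [hn1] at e1
  have hJ := (JJ_pos (n - 1 + D)).ne'
  simp only [sphereMeasure, integral_smul_measure, smul_eq_mul]
  have e2 : ∫ v, evalS (∑ i, pderiv i (pderiv i p)) v ∂(volume : Measure (EE n)).toSphere =
      ((D : ℝ) + 2) * (D + n) * ∫ v, evalS p v ∂(volume : Measure (EE n)).toSphere := by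
    apply mul_right_cancel₀ hJ
    rw [e1]; ring
  rw [e2]; ring

lemma sum_sq_sphere {n : ℕ} (v : Metric.sphere (0 : EE n) 1) :
    ∑ i, (v : EE n) i ^ 2 = 1 := by
  have h : ‖(v : EE n)‖ = 1 := by simp
  rw [← EuclideanSpace.real_norm_sq_eq, h, one_pow]

lemma evalS_rPow {n k : ℕ} (v : Metric.sphere (0 : EE n) 1) : evalS (rPow n k) v = 1 := by
  simp [evalS, rPow, sum_sq_sphere]

lemma evalS_pderiv_rPow {n k : ℕ} (i : Fin n) (v : Metric.sphere (0 : EE n) 1) :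
    evalS (pderiv i (rPow n k)) v = 2 * k * (v : EE n) i := by
  simp only [evalS, rPow, Derivation.leibniz_pow, map_sum, pderiv_X]
  simp [sum_sq_sphere, Pi.single_apply]
  ring

lemma euler_sphere {n D : ℕ} {h : MvPolynomial (Fin n) ℝ} (hh : h.IsHomogeneous D)
    (v : Metric.sphere (0 : EE n) 1) :
    ∑ i, (v : EE n) i * evalS (pderiv i h) v = D * evalS h v := by
  have := congrArg (fun q => evalS q v) hh.sum_X_mul_pderiv
  simpa [evalS] using this

lemma laplacian_sq {n : ℕ} {h : MvPolynomial (Fin n) ℝ}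
    (hharm : (∑ i : Fin n, pderiv i (pderiv i h)) = 0) :
    ∑ i, pderiv i (pderiv i (h * h)) = 2 * ∑ i, pderiv i h * pderiv i h := by
  have : ∀ i, pderiv i (pderiv i (h * h)) =
      2 * h * pderiv i (pderiv i h) + 2 * (pderiv i h * pderiv i h) := by
    intro i
    simp only [Derivation.leibniz, map_add, smul_eq_mul]
    ring
  simp_rw [this, Finset.sum_add_distrib, ← Finset.mul_sum, hharm]
  simp

theorem gradient_identity_r_times_harmonic (n k d : ℕ) (hn : 2 ≤ n) (hk : 1 ≤ k)
    (hd : 1 ≤ d) (hdk : d ≤ k)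
    (h : MvPolynomial (Fin n) ℝ) (hh : h.IsHomogeneous (2 * d))
    (hharm : (∑ i : Fin n, pderiv i (pderiv i h)) = 0)
    (f : MvPolynomial (Fin n) ℝ) (hf : f = rPow n (k - d) * h) :
    gradInner n k f f =
        ((2 * (k : ℝ) ^ 2 + (d : ℝ) * ((n : ℝ) - 2) + 2 * (d : ℝ) ^ 2) / (2 * (k : ℝ) ^ 2)) *
          L2inner n f f ∧
      (∫ v, (∑ i : Fin n, (evalS (pderiv i f) v) ^ 2) ∂(sphereMeasure n)) =
        2 * (2 * (k : ℝ) ^ 2 + (d : ℝ) * ((n : ℝ) - 2) + 2 * (d : ℝ) ^ 2) *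
          ∫ v, (evalS h v) ^ 2 ∂(sphereMeasure n) := by
  have hL2 : L2inner n f f = ∫ v, (evalS h v) ^ 2 ∂(sphereMeasure n) := by
    unfold L2inner
    refine integral_congr_ae (.of_forall fun v => ?_)
    have : evalS f v = evalS h v := by
      have h1 := evalS_rPow (n := n) (k := k - d) v
      simp only [evalS] at h1 ⊢
      rw [hf, map_mul, h1, one_mul]
    simp only [this]; ring
  have hm : ((k - d : ℕ) : ℝ) = k - d := by push_cast [hdk]; ring
  have hpt : ∀ v, ∑ i : Fin n, (evalS (pderiv i f) v) ^ 2 =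
      (4 * (k : ℝ) ^ 2 - 4 * d ^ 2) * evalS h v ^ 2
        + evalS (∑ i, pderiv i h * pderiv i h) v := by
    intro v
    have hi : ∀ i, evalS (pderiv i f) v =
        2 * (k - d : ℝ) * (v : EE n) i * evalS h v + evalS (pderiv i h) v := by
      intro i
      have h1 := evalS_rPow (n := n) (k := k - d) v
      have h2 := evalS_pderiv_rPow (n := n) (k := k - d) i v
      rw [hm] at h2
      simp only [evalS] at h1 h2 ⊢
      rw [hf, Derivation.leibniz]
      simp only [smul_eq_mul, map_add, map_mul, h1, h2]
      ring
    have he := euler_sphere hh v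
    have hs := sum_sq_sphere v
    have hq : evalS (∑ i, pderiv i h * pderiv i h) v = ∑ i, evalS (pderiv i h) v ^ 2 := by
      simp [evalS, pow_two]
    have : ∀ i, (evalS (pderiv i f) v) ^ 2 =
        (4 * (k - d : ℝ) ^ 2 * evalS h v ^ 2) * (v : EE n) i ^ 2
        + (4 * (k - d : ℝ) * evalS h v) * ((v : EE n) i * evalS (pderiv i h) v)
        + evalS (pderiv i h) v ^ 2 := by
      intro i; rw [hi]; ring
    simp_rw [this, Finset.sum_add_distrib, ← Finset.mul_sum, he, hs, hq]
    push_cast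
    ring
  have hfin : IsFiniteMeasure (sphereMeasure n) := by
    constructor
    simp only [sphereMeasure, Measure.smul_apply, smul_eq_mul]
    exact (ENNReal.inv_mul_le_one _).trans_lt ENNReal.one_lt_top
  have hint : ∀ p : MvPolynomial (Fin n) ℝ, Integrable (evalS p) (sphereMeasure n) := fun p =>
    (continuous_evalS p).integrable_of_hasCompactSupport (HasCompactSupport.of_compactSpace _)
  have hsq : ∀ v, evalS h v ^ 2 = evalS (h * h) v := by
    intro v; simp [evalS, pow_two]
  have hlap : ∫ v, evalS (∑ i, pderiv i h * pderiv i h) v ∂(sphereMeasure n) =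
      2 * d * (4 * d + n - 2) * ∫ v, (evalS h v) ^ 2 ∂(sphereMeasure n) := by
    obtain ⟨D, hD⟩ : ∃ D, 2 * d + 2 * d = D + 2 := ⟨4 * d - 2, by omega⟩
    have hp := hh.mul hh
    rw [hD] at hp
    have := sphere_laplacian hn hp
    rw [laplacian_sq hharm] at this
    have h2 : ∀ v, evalS (2 * ∑ i, pderiv i h * pderiv i h) v =
        2 * evalS (∑ i, pderiv i h * pderiv i h) v := by
      intro v; simp [evalS]
    simp_rw [h2, integral_const_mul, ← hsq] at this
    have hD' : (D : ℝ) = 4 * d - 2 := by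
      have : (2 * d + 2 * d : ℝ) = D + 2 := by exact_mod_cast hD
      linarith
    rw [hD'] at this
    linarith
  have main : (∫ v, (∑ i : Fin n, (evalS (pderiv i f) v) ^ 2) ∂(sphereMeasure n)) =
        2 * (2 * (k : ℝ) ^ 2 + (d : ℝ) * ((n : ℝ) - 2) + 2 * (d : ℝ) ^ 2) *
          ∫ v, (evalS h v) ^ 2 ∂(sphereMeasure n) := by
    simp_rw [hpt]
    rw [integral_add _ (hint _), integral_const_mul, hlap]
    · ring
    · simp_rw [hsq]
      exact (hint _).const_mul _
  refine ⟨?_, main⟩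
  have hk0 : (k : ℝ) ≠ 0 := by positivity
  simp_rw [gradInner, ← pow_two, main, hL2]
  field_simp
  ring
end
end

section
/- Let n ≥ 1 and k ≥ 1. The cone Lf of sums of 2k-th powers of linear forms is the dual cone of the cone C of nonnegative forms with respect to the differential inner product: f ∈ P_{n,2k} is a sum of 2k-th powers of linear forms if and only if ⟨f, g⟩_d ≥ 0 for every g ∈ P_{n,2k} with g(x) ≥ 0 for all x ∈ ℝⁿ. -/
open MeasureTheory MvPolynomial

noncomputable section

/-- Multi-indices of degree `d`. -/
def idx (n d : ℕ) : Finset (Fin n →₀ ℕ) := Finset.finsuppAntidiag Finset.univ d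

lemma mem_idx {n d : ℕ} {a : Fin n →₀ ℕ} : a ∈ idx n d ↔ ∑ i, a i = d := by
  simp [idx]

lemma facpos {n : ℕ} (a : Fin n →₀ ℕ) : 0 < ∏ i, (Nat.factorial (a i) : ℝ) :=
  Finset.prod_pos fun i _ => by positivity

lemma coeff_linForm_pow {n d : ℕ} (v : Fin n → ℝ) {a : Fin n →₀ ℕ} (ha : a ∈ idx n d) :
    coeff a (linForm n v ^ d) =
      (d.factorial : ℝ) / (∏ i, (Nat.factorial (a i) : ℝ)) * ∏ i, v i ^ a i := by
  have h := coeff_linearCombination_X_pow_of_fintype v a d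
  simp only [smul_eq_C_mul] at h
  rw [mem_idx] at ha
  have hs : a.sum (fun _ m => m) = d := by
    rw [Finsupp.sum_fintype _ _ (fun _ => rfl)]; exact ha
  rw [if_pos hs, Finsupp.multinomial_eq_of_support_subset (Finset.subset_univ a.support),
    Finsupp.prod_fintype _ _ (fun _ => pow_zero _)] at h
  rw [linForm, h]
  congr 1
  rw [eq_div_iff (facpos a).ne']
  have := Nat.multinomial_spec Finset.univ (a : Fin n → ℕ)
  rw [ha] at this
  rw [← this]
  push_cast
  ring

lemma support_sub_idx {n d : ℕ} {f : MvPolynomial (Fin n) ℝ} (hf : f.IsHomogeneous d) :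
    f.support ⊆ idx n d := by
  intro a ha
  rw [mem_idx]
  have := hf (mem_support_iff.1 ha)
  rw [← this, Finsupp.weight_apply, Finsupp.sum_fintype _ _ (by simp)]
  simp

lemma diffInner_eq {n d : ℕ} {f : MvPolynomial (Fin n) ℝ} (hf : f.IsHomogeneous d)
    (g : MvPolynomial (Fin n) ℝ) :
    diffInner n f g =
      ∑ a ∈ idx n d, (∏ i, (Nat.factorial (a i) : ℝ)) * f.coeff a * g.coeff a := by
  refine Finset.sum_subset (support_sub_idx hf) fun a _ ha => ?_
  rw [notMem_support_iff.1 ha]; ring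

lemma eval_eq_idx {n d : ℕ} {g : MvPolynomial (Fin n) ℝ} (hg : g.IsHomogeneous d)
    (x : Fin n → ℝ) : eval x g = ∑ a ∈ idx n d, g.coeff a * ∏ i, x i ^ a i := by
  rw [eval_eq']
  refine Finset.sum_subset (support_sub_idx hg) fun a _ ha => ?_
  rw [notMem_support_iff.1 ha]; ring

lemma linForm_hom {n : ℕ} (v : Fin n → ℝ) : (linForm n v).IsHomogeneous 1 := by
  refine IsHomogeneous.sum _ _ _ fun i _ => ?_
  simpa using (isHomogeneous_C (Fin n) (v i)).mul (isHomogeneous_X ℝ i)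

lemma exists_linForm {n : ℕ} {l : MvPolynomial (Fin n) ℝ} (hl : l.IsHomogeneous 1) :
    ∃ v, l = linForm n v := by
  refine ⟨fun i => l.coeff (Finsupp.single i 1), ?_⟩
  ext a
  by_cases ha : a ∈ idx n 1
  · have hd : a.sum (fun _ m => m) = 1 := by
      rw [Finsupp.sum_fintype _ _ (fun _ => rfl)]; exact mem_idx.1 ha
    obtain ⟨i, rfl⟩ := (Finsupp.sum_eq_one_iff a).1 hd
    simp [linForm, coeff_sum, coeff_C_mul, coeff_X, Finsupp.single_left_inj]
  · rw [notMem_support_iff.1 fun h => ha (support_sub_idx hl h),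
      notMem_support_iff.1 fun h => ha (support_sub_idx (linForm_hom _) h)]

/-- Scaled moment vector. -/
def phi (n d : ℕ) (v : Fin n → ℝ) : idx n d → ℝ := fun a =>
  (d.factorial : ℝ) / (∏ i, (Nat.factorial (a.1 i) : ℝ)) * ∏ i, v i ^ a.1 i

lemma phi_smul {n d : ℕ} (t : ℝ) (v : Fin n → ℝ) : phi n d (t • v) = t ^ d • phi n d v := by
  ext a
  have := mem_idx.1 a.2
  simp only [phi, Pi.smul_apply, smul_eq_mul, mul_pow, Finset.prod_mul_distrib,
    Finset.prod_pow_eq_pow_sum, this]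
  ring

lemma phi_zero {n d : ℕ} (hd : d ≠ 0) : phi n d 0 = 0 := by
  have := phi_smul (n := n) (d := d) 0 0
  simpa [hd] using this

lemma phi_continuous {n d : ℕ} : Continuous (phi n d) := by
  unfold phi; fun_prop

/-- Sum of `N` moment vectors. -/
def Phi (n d N : ℕ) (v : Fin N → Fin n → ℝ) : idx n d → ℝ := ∑ i, phi n d (v i)

lemma phi_smul_mem {n k : ℕ} (hk : 1 ≤ k) {c : ℝ} (hc : 0 ≤ c) (v : Fin n → ℝ) :
    ∃ u, phi n (2 * k) u = c • phi n (2 * k) v := by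
  refine ⟨(c ^ ((2 * k : ℕ) : ℝ)⁻¹) • v, ?_⟩
  rw [phi_smul, Real.rpow_inv_natCast_pow hc (by omega)]

lemma single_mem {n d : ℕ} (j : Fin n) : Finsupp.single j d ∈ idx n d := by
  rw [mem_idx]; simp [Finsupp.single_apply]

lemma phi_single {n d : ℕ} (v : Fin n → ℝ) (j : Fin n) :
    phi n d v ⟨Finsupp.single j d, single_mem j⟩ = v j ^ d := by
  have h1 : ∏ i, (Nat.factorial ((Finsupp.single j d) i) : ℝ) = d.factorial := by
    rw [Finset.prod_eq_single j] <;> simp +contextual [eq_comm]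
  have h2 : ∏ i, v i ^ ((Finsupp.single j d) i) = v j ^ d := by
    rw [Finset.prod_eq_single j] <;> simp +contextual [eq_comm]
  simp only [phi, h1, h2]
  rw [div_self (by positivity), one_mul]

lemma Phi_range_closed {n k : ℕ} (hk : 1 ≤ k) (N : ℕ) :
    IsClosed (Set.range (Phi n (2 * k) N)) := by
  have hcont : Continuous (Phi n (2 * k) N) := by
    unfold Phi
    exact continuous_finsetSum _ fun i _ => phi_continuous.comp (continuous_apply i)
  apply IsProperMap.isClosed_range
  rw [isProperMap_iff_isCompact_preimage]
  refine ⟨hcont, fun K hK => ?_⟩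
  obtain ⟨R, hR⟩ := hK.isBounded.exists_norm_le
  refine Metric.isCompact_of_isClosed_isBounded (hK.isClosed.preimage hcont) ?_
  rw [isBounded_iff_forall_norm_le]
  refine ⟨1 + |R|, fun v hv => ?_⟩
  have hv' := hR _ hv
  refine (pi_norm_le_iff_of_nonneg (by positivity)).2 fun i =>
    (pi_norm_le_iff_of_nonneg (by positivity)).2 fun j => ?_
  have h1 := (norm_le_pi_norm (Phi n (2 * k) N v) ⟨Finsupp.single j (2 * k), single_mem j⟩)
  have h2 : Phi n (2 * k) N v ⟨Finsupp.single j (2 * k), single_mem j⟩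
      = ∑ i, v i j ^ (2 * k) := by
    simp only [Phi, Finset.sum_apply, phi_single]
  have hnn : ∀ i, 0 ≤ v i j ^ (2 * k) := fun i => by
    rw [pow_mul]; positivity
  have h3 : v i j ^ (2 * k) ≤ ∑ i, v i j ^ (2 * k) :=
    Finset.single_le_sum (f := fun i => v i j ^ (2 * k)) (fun i _ => hnn i) (Finset.mem_univ i)
  have h4 : v i j ^ (2 * k) ≤ |R| := by
    rw [h2] at h1
    exact h3.trans ((le_abs_self _).trans (h1.trans (hv'.trans (le_abs_self _))))
  rw [Real.norm_eq_abs]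
  by_contra hlt
  push Not at hlt
  have h5 : 1 ≤ |v i j| := by linarith [abs_nonneg R]
  have h6 : |v i j| ≤ |v i j| ^ (2 * k) := le_self_pow₀ h5 (by omega)
  rw [(even_two_mul k).pow_abs] at h6
  linarith

lemma convexHull_eq_range {n k : ℕ} (hk : 1 ≤ k) :
    convexHull ℝ (Set.range (phi n (2 * k))) =
      Set.range (Phi n (2 * k) (Module.finrank ℝ (idx n (2 * k) → ℝ) + 1)) := by
  set N := Module.finrank ℝ (idx n (2 * k) → ℝ) + 1 with hN
  apply Set.Subset.antisymm
  · intro x hx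
    obtain ⟨ι, _, z, w, hz, hind, hw, -, rfl⟩ := eq_pos_convex_span_of_mem_convexHull hx
    have hcard : Fintype.card ι ≤ N := hind.card_le_finrank_succ.trans
      (Nat.succ_le_succ (Submodule.finrank_le _))
    have : ∀ i, ∃ u, phi n (2 * k) u = w i • z i := fun i => by
      obtain ⟨v, hv⟩ := hz ⟨i, rfl⟩
      rw [← hv]
      exact phi_smul_mem hk (hw i).le v
    choose u hu using this
    obtain ⟨e⟩ : Nonempty (ι ↪ Fin N) :=
      Function.Embedding.nonempty_of_card_le (by simpa using hcard)
    refine ⟨Function.extend e u 0, ?_⟩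
    unfold Phi
    simp only [← hu]
    symm
    apply Finset.sum_of_injOn e e.injective.injOn
    · intro i _; simp
    · intro j _ hj
      rw [Function.extend_apply']
      · exact phi_zero (by omega)
      · rintro ⟨i, hi⟩
        exact hj ⟨i, by simp, hi⟩
    · intro i _
      rw [e.injective.extend_apply]
  · rintro _ ⟨v, rfl⟩
    have hNpos : (0 : ℝ) < N := by rw [hN]; positivity
    choose u hu using fun i => phi_smul_mem hk hNpos.le (v i)
    have h : Phi n (2 * k) N v = ∑ i : Fin N, (1 / (N : ℝ)) • phi n (2 * k) (u i) := by
      unfold Phi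
      refine Finset.sum_congr rfl fun i _ => ?_
      rw [hu, smul_smul, one_div, inv_mul_cancel₀ hNpos.ne', one_smul]
    rw [h]
    refine (convex_convexHull ℝ _).sum_mem (fun _ _ => by positivity) ?_
      fun i _ => subset_convexHull ℝ _ ⟨u i, rfl⟩
    simp [hNpos.ne']

theorem powers_cone_dual_of_nonneg (n k : ℕ) (hn : 1 ≤ n) (hk : 1 ≤ k)
    (f : MvPolynomial (Fin n) ℝ) (hf : f.IsHomogeneous (2 * k)) :
    IsSOP n k f ↔
      ∀ g : MvPolynomial (Fin n) ℝ, g.IsHomogeneous (2 * k) →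
        (∀ x : Fin n → ℝ, 0 ≤ eval x g) → 0 ≤ diffInner n f g := by
  constructor
  · rintro ⟨m, l, hl, rfl⟩ g hg hpos
    choose v hv using fun i => exists_linForm (hl i)
    rw [diffInner_eq hf]
    have : ∀ a ∈ idx n (2 * k),
        (∏ i, (Nat.factorial (a i) : ℝ)) * coeff a (∑ i, l i ^ (2 * k)) * coeff a g =
        ∑ j, ((2 * k).factorial : ℝ) * (coeff a g * ∏ i, v j i ^ a i) := by
      intro a ha
      rw [coeff_sum, Finset.mul_sum, Finset.sum_mul]
      refine Finset.sum_congr rfl fun j _ => ?_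
      rw [hv j, coeff_linForm_pow _ ha]
      have := (facpos a).ne'
      field_simp
    rw [Finset.sum_congr rfl this, Finset.sum_comm]
    refine Finset.sum_nonneg fun j _ => ?_
    rw [← Finset.mul_sum, ← eval_eq_idx hg]
    exact mul_nonneg (by positivity) (hpos _)
  · intro h
    let F : idx n (2 * k) → ℝ := fun a => coeff a.1 f
    have hcl : IsClosed (convexHull ℝ (Set.range (phi n (2 * k)))) := by
      rw [convexHull_eq_range hk]; exact Phi_range_closed hk _
    by_cases hF : F ∈ convexHull ℝ (Set.range (phi n (2 * k)))
    · rw [convexHull_eq_range hk] at hF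
      obtain ⟨v, hv⟩ := hF
      refine ⟨_, fun i => linForm n (v i), fun i => linForm_hom _, ?_⟩
      have hhom : (∑ i, linForm n (v i) ^ (2 * k)).IsHomogeneous (2 * k) :=
        IsHomogeneous.sum _ _ _ fun i _ => by simpa using (linForm_hom (v i)).pow (2 * k)
      ext a
      by_cases ha : a ∈ idx n (2 * k)
      · have := congrFun hv ⟨a, ha⟩
        simp only [Phi, Finset.sum_apply, phi, F] at this
        rw [← this, coeff_sum]
        exact Finset.sum_congr rfl fun i _ => (coeff_linForm_pow _ ha).symm
      · rw [notMem_support_iff.1 fun h => ha (support_sub_idx hf h),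
          notMem_support_iff.1 fun h => ha (support_sub_idx hhom h)]
    · exfalso
      obtain ⟨L, u, hLF, hLs⟩ := geometric_hahn_banach_point_closed
        (convex_convexHull ℝ _) hcl hF
      have hLphi : ∀ v, u < L (phi n (2 * k) v) := fun v =>
        hLs _ (subset_convexHull ℝ _ ⟨v, rfl⟩)
      have hu : u < 0 := by
        have := hLphi 0
        rwa [phi_zero (by omega), map_zero] at this
      have hLnn : ∀ v, 0 ≤ L (phi n (2 * k) v) := by
        intro v
        by_contra hneg
        push Not at hneg
        obtain ⟨w, hw⟩ := phi_smul_mem hk (c := u / L (phi n (2 * k) v))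
          (div_nonneg_of_nonpos hu.le hneg.le) v
        have := hLphi w
        rw [hw, map_smul, smul_eq_mul, div_mul_cancel₀ _ hneg.ne] at this
        exact lt_irrefl _ this
      have hL : ∀ y : idx n (2 * k) → ℝ, L y = ∑ a, y a * L (Pi.single a 1) := by
        intro y
        conv_lhs => rw [pi_eq_sum_univ' y]
        simp [map_sum]
      let G : MvPolynomial (Fin n) ℝ := ∑ a : idx n (2 * k),
        monomial a.1 (L (Pi.single a 1) / ∏ i, (Nat.factorial (a.1 i) : ℝ))
      have hG : G.IsHomogeneous (2 * k) := by
        refine IsHomogeneous.sum _ _ _ fun a _ => isHomogeneous_monomial _ ?_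
        rw [Finsupp.degree_eq_sum]
        exact mem_idx.1 a.2
      have hGc : ∀ a : idx n (2 * k), coeff a.1 G =
          L (Pi.single a 1) / ∏ i, (Nat.factorial (a.1 i) : ℝ) := by
        intro a
        simp only [G, coeff_sum, coeff_monomial]
        rw [Finset.sum_eq_single a]
        · simp
        · intro b _ hb
          rw [if_neg (fun h => hb (Subtype.ext h))]
        · simp
      have hGpos : ∀ x : Fin n → ℝ, 0 ≤ eval x G := by
        intro x
        have h1 := hLnn x
        have h2 : L (phi n (2 * k) x) = ((2 * k).factorial : ℝ) * eval x G := by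
          rw [hL, eval_eq_idx hG, ← Finset.sum_coe_sort (idx n (2 * k)), Finset.mul_sum]
          refine Finset.sum_congr rfl fun a _ => ?_
          rw [hGc, phi]
          ring
        rw [h2] at h1
        exact nonneg_of_mul_nonneg_right h1 (by positivity)
      have h3 := h G hG hGpos
      have h4 : diffInner n f G = L F := by
        rw [diffInner_eq hf, hL, ← Finset.sum_coe_sort (idx n (2 * k))]
        refine Finset.sum_congr rfl fun a _ => ?_
        rw [hGc]
        have := (facpos a.1).ne'
        simp only [F]
        field_simp
      linarith
end
end
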